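/- Let p_1, ..., p_n be distinct primes, let α_1 ≥ ... ≥ α_u > α_{u+1} = ... = α_n = 1 (with u = 0 if all α_i equal 1), and let N = p_1^{α_1}···p_n^{α_n}. Let D be a maximal N-set with |D| = α_n · ∏_{i=1}^{n-1}(α_i + 1) and suppose {p_{u+1}, ..., p_n} ∩ D = ∅. Let N' = p_1···p_n, A = { d : d ∣ N', d ∈ D }, and A_n' = { d ∈ A : p_n ∤ d }. Then for every v with 1 ≤ v ≤ u, |{ d ∈ A_n' : p_v ∣ d }| = |{ d ∈ A_n' : p_v ∤ d }| = |A_n'|/2. -/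

import Mathlib

open Finset

/-- `D` is an `N`-set: a set of positive divisors of `N`, no two elements of which
are coprime. -/
def IsNSet (N : ℕ) (D : Finset ℕ) : Prop :=
  (∀ d ∈ D, d ∣ N) ∧ (∀ d ∈ D, ∀ e ∈ D, Nat.gcd d e ≠ 1)

/-- An `N`-set `D` is maximal if no further divisor of `N` can be added while keeping
the property that no two elements are coprime. -/
def IsMaxNSet (N : ℕ) (D : Finset ℕ) : Prop :=
  IsNSet N D ∧ ∀ l, l ∣ N → l ∉ D → ∃ d ∈ D, Nat.gcd l d = 1

/-- `dSet D` is the set of divisible minimal elements of `D`: those elements of `D`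
not divisible by any other element of `D`. -/
def dSet (D : Finset ℕ) : Finset ℕ :=
  D.filter fun d => ∀ e ∈ D, e ∣ d → e = d

/-- `RSet T N` is `R(T, N)`: the set of positive divisors of `N` divisible by at least
one element of `T`. -/
def RSet (T : Finset ℕ) (N : ℕ) : Finset ℕ :=
  N.divisors.filter fun l => ∃ t ∈ T, t ∣ l

section Upsets

variable {ι : Type*}

theorem sum_ite_prod_nonneg {a : ι → ℤ} (ha : ∀ i, 1 ≤ a i) (s : Finset ι)
    (Q : Finset ι → Prop) [DecidablePred Q] :
    0 ≤ ∑ T ∈ s.powerset, if Q T then ∏ i ∈ T, a i else 0 := by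
  refine Finset.sum_nonneg fun T _ => ?_
  split_ifs
  · exact Finset.prod_nonneg fun i _ => by linarith [ha i]
  · exact le_rfl

variable [DecidableEq ι]

/-- The excess of the total weight of the members of the family `P` of subsets of `s`
over the total weight of their complements in `s`, the weight of a set being the
product of `a` over it. -/
def weightExcess (a : ι → ℤ) (s : Finset ι) (P : Finset ι → Prop) [DecidablePred P] : ℤ :=
  ∑ T ∈ s.powerset, if P T then ∏ i ∈ T, a i - ∏ i ∈ s \ T, a i else 0

theorem weightExcess_insert (a : ι → ℤ) {s : Finset ι} {v : ι} (hv : v ∉ s)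
    (P : Finset ι → Prop) [DecidablePred P] (hP : ∀ S T, S ⊆ T → P S → P T) :
    weightExcess a (insert v s) P =
      (a v - 1) * (weightExcess a s P +
        ∑ T ∈ s.powerset, if P (insert v T) ∧ ¬ P T then ∏ i ∈ T, a i else 0) +
      weightExcess a s P + weightExcess a s (fun T => P (insert v T)) := by
  unfold weightExcess
  rw [Finset.sum_powerset_insert hv, mul_add, Finset.mul_sum, Finset.mul_sum,
    ← Finset.sum_add_distrib, ← Finset.sum_add_distrib, ← Finset.sum_add_distrib,
    ← Finset.sum_add_distrib]
  refine Finset.sum_congr rfl fun T hT => ?_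
  have hTs : T ⊆ s := Finset.mem_powerset.1 hT
  have hvT : v ∉ T := fun h => hv (hTs h)
  have h1 : insert v s \ T = insert v (s \ T) := Finset.insert_sdiff_of_notMem _ hvT
  have h2 : insert v s \ insert v T = s \ T := by
    ext x
    simp only [Finset.mem_sdiff, Finset.mem_insert]
    grind
  have h3 : v ∉ s \ T := fun h => hv (Finset.mem_sdiff.1 h).1
  rw [h1, h2, Finset.prod_insert h3, Finset.prod_insert hvT]
  have h4 : P T → P (insert v T) := hP _ _ (Finset.subset_insert _ _)
  by_cases h5 : P T
  · simp only [h5, h4 h5, not_true_eq_false, and_false, if_true, if_false]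
    ring
  · by_cases h6 : P (insert v T)
    · simp only [h5, h6, not_false_eq_true, and_true, if_true, if_false]
      ring
    · simp only [h5, h6, false_and, if_false]
      ring

theorem weightExcess_nonneg {a : ι → ℤ} (ha : ∀ i, 1 ≤ a i) (s : Finset ι)
    (P : Finset ι → Prop) [DecidablePred P] (hP : ∀ S T, S ⊆ T → P S → P T) :
    0 ≤ weightExcess a s P := by
  induction s using Finset.induction_on generalizing P with
  | empty => simp [weightExcess]
  | insert v s hv ih =>
    rw [weightExcess_insert a hv P hP]
    have h0 := ih P hP
    have h1 := ih (fun T => P (insert v T))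
      fun S T hST => hP _ _ (Finset.insert_subset_insert _ hST)
    have h2 := sum_ite_prod_nonneg ha s fun T => P (insert v T) ∧ ¬ P T
    have h3 := mul_nonneg (sub_nonneg.2 (ha v)) (add_nonneg h0 h2)
    linarith

/-- If an up-closed family has zero weight excess, then it does not depend on the
elements of weight greater than one. -/
theorem of_insert_of_weightExcess_eq_zero {a : ι → ℤ} (ha : ∀ i, 1 ≤ a i) {s : Finset ι}
    {v : ι} (hv : v ∉ s) (hav : 1 < a v) (P : Finset ι → Prop) [DecidablePred P]
    (hP : ∀ S T, S ⊆ T → P S → P T) (h : weightExcess a (insert v s) P = 0)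
    {T : Finset ι} (hT : T ⊆ s) (hvT : P (insert v T)) : P T := by
  by_contra hPT
  rw [weightExcess_insert a hv P hP] at h
  have h0 := weightExcess_nonneg ha s P hP
  have h1 := weightExcess_nonneg ha s (fun T => P (insert v T))
      fun S T hST => hP _ _ (Finset.insert_subset_insert _ hST)
  have h2 : 0 < ∑ T ∈ s.powerset, if P (insert v T) ∧ ¬ P T then ∏ i ∈ T, a i else 0 := by
    refine Finset.sum_pos' (fun S _ => ?_) ⟨T, Finset.mem_powerset.2 hT, ?_⟩
    · split_ifs
      · exact Finset.prod_nonneg fun i _ => by linarith [ha i]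
      · exact le_rfl
    · rw [if_pos ⟨hvT, hPT⟩]
      exact Finset.prod_pos fun i _ => by linarith [ha i]
  have h3 := mul_pos (sub_pos.2 hav) (add_pos_of_nonneg_of_pos h0 h2)
  linarith

/-- Suppose the family `P` contains exactly one of each set and its complement, and
that `a z = 1`. Then the total weight of `P` exceeds that of the family of all sets
containing `z` by the weight excess of the members of `P` avoiding `z`. -/
theorem sum_prod_eq_add_weightExcess [Fintype ι] (a : ι → ℤ) {z : ι} (hz : a z = 1)
    (P : Finset ι → Prop) [DecidablePred P] (hP : ∀ S, P Sᶜ ↔ ¬ P S) :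
    (∑ S ∈ Finset.univ.filter P, ∏ i ∈ S, a i) =
      ∏ i ∈ Finset.univ.erase z, (a i + 1) + weightExcess a (Finset.univ.erase z) P := by
  have hzs : z ∉ Finset.univ.erase z := Finset.notMem_erase _ _
  set s := Finset.univ.erase z with hs
  have hu : (Finset.univ : Finset (Finset ι)) = (insert z s).powerset := by
    rw [hs, Finset.insert_erase (Finset.mem_univ z), Finset.powerset_univ]
  rw [Finset.sum_filter, hu, Finset.sum_powerset_insert hzs, Finset.prod_add_one]
  have key : ∀ T ∈ s.powerset, (if P (insert z T) then ∏ i ∈ insert z T, a i else 0) =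
      ∏ i ∈ T, a i - if P (s \ T) then ∏ i ∈ T, a i else 0 := by
    intro T hT
    have hzT : z ∉ T := fun h => hzs (Finset.mem_powerset.1 hT h)
    have hc : s \ T = (insert z T)ᶜ := by
      ext x
      simp only [hs, Finset.mem_sdiff, Finset.mem_erase, Finset.mem_univ, Finset.mem_compl,
        Finset.mem_insert]
      tauto
    rw [hc, Finset.prod_insert hzT, hz, one_mul]
    by_cases h : P (insert z T)
    · rw [if_pos h, if_neg ((hP _).not.2 (not_not.2 h)), sub_zero]
    · rw [if_neg h, if_pos ((hP _).2 h), sub_self]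
  have hinv : (∑ T ∈ s.powerset, if P (s \ T) then ∏ i ∈ T, a i else 0) =
      ∑ T ∈ s.powerset, if P T then ∏ i ∈ s \ T, a i else 0 := by
    refine Finset.sum_nbij' (fun T => s \ T) (fun T => s \ T) ?_ ?_ ?_ ?_ ?_
    · exact fun T _ => Finset.mem_powerset.2 Finset.sdiff_subset
    · exact fun T _ => Finset.mem_powerset.2 Finset.sdiff_subset
    · exact fun T hT => Finset.sdiff_sdiff_eq_self (Finset.mem_powerset.1 hT)
    · exact fun T hT => Finset.sdiff_sdiff_eq_self (Finset.mem_powerset.1 hT)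
    · intro T hT
      simp only [Finset.sdiff_sdiff_eq_self (Finset.mem_powerset.1 hT)]
  rw [Finset.sum_congr rfl key, Finset.sum_sub_distrib, hinv, weightExcess]
  have hsplit : ∀ T ∈ s.powerset,
      (if P T then ∏ i ∈ T, a i - ∏ i ∈ s \ T, a i else 0) =
      (if P T then ∏ i ∈ T, a i else 0) - if P T then ∏ i ∈ s \ T, a i else 0 := by
    intro T _
    split_ifs <;> simp
  rw [Finset.sum_congr rfl hsplit, Finset.sum_sub_distrib]
  ring

end Upsets

section Divisors

variable {ι : Type*} {p α : ι → ℕ} {D : Finset ℕ}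

theorem dvd_prod_primes_iff (hp : ∀ i, (p i).Prime) (hinj : Function.Injective p)
    (S : Finset ι) (i : ι) : p i ∣ ∏ j ∈ S, p j ↔ i ∈ S := by
  refine ⟨fun h => ?_, fun h => Finset.dvd_prod_of_mem _ h⟩
  obtain ⟨j, hj, hij⟩ := (Prime.dvd_finsetProd_iff (hp i).prime _).1 h
  rwa [hinj ((Nat.prime_dvd_prime_iff_eq (hp i) (hp j)).1 hij)]

variable [Fintype ι]

theorem factorization_prod_pow_apply (hp : ∀ i, (p i).Prime) (hinj : Function.Injective p)
    (e : ι → ℕ) (i : ι) : (∏ j, p j ^ e j).factorization (p i) = e i := by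
  rw [Nat.factorization_prod_apply fun j _ => pow_ne_zero _ (hp j).ne_zero]
  rw [Finset.sum_eq_single i]
  · rw [(hp i).factorization_pow, Finsupp.single_eq_same]
  · intro j _ hj
    rw [(hp j).factorization_pow, Finsupp.single_eq_of_ne (hinj.ne hj.symm)]
  · simp

theorem exists_eq_of_prime_dvd_prod_pow (hp : ∀ i, (p i).Prime) {q : ℕ} (hq : q.Prime)
    (h : q ∣ ∏ i, p i ^ α i) : ∃ i, q = p i := by
  obtain ⟨i, -, hi⟩ := (Prime.dvd_finsetProd_iff hq.prime _).1 h
  exact ⟨i, (Nat.prime_dvd_prime_iff_eq hq (hp i)).1 (hq.dvd_of_dvd_pow hi)⟩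

theorem eq_prod_pow_factorization (hp : ∀ i, (p i).Prime) (hinj : Function.Injective p)
    {d : ℕ} (hd : d ∣ ∏ i, p i ^ α i) : d = ∏ i, p i ^ d.factorization (p i) := by
  have hN : ∏ i, p i ^ α i ≠ 0 :=
    Finset.prod_ne_zero_iff.2 fun j _ => pow_ne_zero _ (hp j).ne_zero
  have hd0 : d ≠ 0 := fun h => hN (by rw [h] at hd; exact zero_dvd_iff.1 hd)
  refine Nat.eq_of_factorization_eq hd0
    (Finset.prod_ne_zero_iff.2 fun j _ => pow_ne_zero _ (hp j).ne_zero) fun q => ?_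
  by_cases hq : ∃ i, q = p i
  · obtain ⟨i, rfl⟩ := hq
    rw [factorization_prod_pow_apply hp hinj]
  · by_cases hqp : q.Prime
    · rw [Nat.factorization_eq_zero_of_not_dvd, Nat.factorization_eq_zero_of_not_dvd]
      · exact fun h => hq (exists_eq_of_prime_dvd_prod_pow hp hqp h)
      · exact fun h => hq (exists_eq_of_prime_dvd_prod_pow hp hqp (h.trans hd))
    · rw [Nat.factorization_eq_zero_of_not_prime _ hqp,
        Nat.factorization_eq_zero_of_not_prime _ hqp]

theorem prod_primes_dvd_prod_pow (hα : ∀ i, 1 ≤ α i) (S : Finset ι) :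
    ∏ j ∈ S, p j ∣ ∏ i, p i ^ α i :=
  (Finset.prod_dvd_prod_of_dvd _ _ fun i _ => dvd_pow_self _ (by have := hα i; omega)).trans
    (Finset.prod_dvd_prod_of_subset _ _ _ (Finset.subset_univ S))

theorem IsMaxNSet.mem_of_forall_dvd (hp : ∀ i, (p i).Prime)
    (hD : IsMaxNSet (∏ i, p i ^ α i) D) {d l : ℕ} (hd : d ∈ D) (hl : l ∣ ∏ i, p i ^ α i)
    (h : ∀ i, p i ∣ d → p i ∣ l) : l ∈ D := by
  by_contra hlD
  obtain ⟨e, he, hle⟩ := hD.2 l hl hlD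
  obtain ⟨q, hq, hqd⟩ := Nat.exists_prime_and_dvd (hD.1.2 d hd e he)
  have hqd' := hqd.trans (Nat.gcd_dvd_left d e)
  obtain ⟨i, rfl⟩ := exists_eq_of_prime_dvd_prod_pow hp hq (hqd'.trans (hD.1.1 d hd))
  have := Nat.dvd_gcd (h i hqd') (hqd.trans (Nat.gcd_dvd_right d e))
  rw [hle] at this
  exact hq.one_lt.ne' (Nat.dvd_one.1 this)

theorem IsMaxNSet.prod_mem_of_subset (hp : ∀ i, (p i).Prime) (hinj : Function.Injective p)
    (hα : ∀ i, 1 ≤ α i) (hD : IsMaxNSet (∏ i, p i ^ α i) D) {S T : Finset ι} (hST : S ⊆ T)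
    (hS : ∏ i ∈ S, p i ∈ D) : ∏ i ∈ T, p i ∈ D :=
  hD.mem_of_forall_dvd hp hS (prod_primes_dvd_prod_pow hα T) fun i hi =>
    (dvd_prod_primes_iff hp hinj T i).2 (hST ((dvd_prod_primes_iff hp hinj S i).1 hi))

variable [DecidableEq ι]

/-- The divisors of `∏ i, p i ^ α i` divisible by exactly the primes `p i` with `i ∈ S`
are `∏ i ∈ S, α i` in number. -/
theorem card_divisors_filter_primes_eq (hp : ∀ i, (p i).Prime) (hinj : Function.Injective p)
    (S : Finset ι) :
    ((∏ i, p i ^ α i).divisors.filter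
      fun d => Finset.univ.filter (fun i => p i ∣ d) = S).card = ∏ i ∈ S, α i := by
  have hN : ∏ i, p i ^ α i ≠ 0 :=
    Finset.prod_ne_zero_iff.2 fun j _ => pow_ne_zero _ (hp j).ne_zero
  have hbox : (Fintype.piFinset fun i => if i ∈ S then Finset.Icc 1 (α i) else {0}).card =
      ∏ i ∈ S, α i := by
    rw [Fintype.card_piFinset, ← Finset.prod_subset (Finset.subset_univ S)]
    · refine Finset.prod_congr rfl fun i hi => ?_
      rw [if_pos hi, Nat.card_Icc, Nat.add_sub_cancel]
    · intro i _ hi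
      rw [if_neg hi, Finset.card_singleton]
  rw [← hbox]
  refine Finset.card_nbij' (fun d i => d.factorization (p i)) (fun e => ∏ i, p i ^ e i)
    ?_ ?_ ?_ ?_
  · intro d hd
    obtain ⟨hdN, rfl⟩ := Finset.mem_filter.1 hd
    have hdN' := Nat.dvd_of_mem_divisors hdN
    have hd0 := Nat.ne_of_gt (Nat.pos_of_mem_divisors hdN)
    refine Fintype.mem_piFinset.2 fun i => ?_
    by_cases hi : p i ∣ d
    · rw [if_pos (by simpa using hi), Finset.mem_Icc]
      refine ⟨(hp i).factorization_pos_of_dvd hd0 hi, ?_⟩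
      have := (Nat.factorization_le_iff_dvd hd0 hN).2 hdN' (p i)
      rwa [factorization_prod_pow_apply hp hinj] at this
    · rw [if_neg (by simpa using hi), Finset.mem_singleton]
      exact Nat.factorization_eq_zero_of_not_dvd hi
  · intro e he
    have he' := Fintype.mem_piFinset.1 he
    refine Finset.mem_filter.2 ⟨Nat.mem_divisors.2 ⟨?_, hN⟩, ?_⟩
    · refine Finset.prod_dvd_prod_of_dvd _ _ fun i _ => pow_dvd_pow _ ?_
      have := he' i
      split_ifs at this
      · exact (Finset.mem_Icc.1 this).2
      · rw [Finset.mem_singleton.1 this]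
        exact Nat.zero_le _
    · ext i
      have h0 : ∏ i, p i ^ e i ≠ 0 :=
        Finset.prod_ne_zero_iff.2 fun j _ => pow_ne_zero _ (hp j).ne_zero
      simp only [Finset.mem_filter, Finset.mem_univ, true_and]
      rw [(hp i).dvd_iff_one_le_factorization h0, factorization_prod_pow_apply hp hinj]
      have := he' i
      split_ifs at this with hi
      · exact iff_of_true (Finset.mem_Icc.1 this).1 hi
      · rw [Finset.mem_singleton] at this
        exact iff_of_false (by omega) hi
  · intro d hd
    exact (eq_prod_pow_factorization hp hinj
      (Nat.dvd_of_mem_divisors (Finset.mem_filter.1 hd).1)).symm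
  · intro e _
    funext i
    exact factorization_prod_pow_apply hp hinj e i

theorem IsMaxNSet.prod_compl_mem_iff (hp : ∀ i, (p i).Prime) (hinj : Function.Injective p)
    (hα : ∀ i, 1 ≤ α i) (hD : IsMaxNSet (∏ i, p i ^ α i) D) (S : Finset ι) :
    ∏ i ∈ Sᶜ, p i ∈ D ↔ ∏ i ∈ S, p i ∉ D := by
  constructor
  · intro hc hS
    obtain ⟨q, hq, hqd⟩ := Nat.exists_prime_and_dvd (hD.1.2 _ hS _ hc)
    obtain ⟨hq1, hq2⟩ := Nat.dvd_gcd_iff.1 hqd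
    obtain ⟨i, rfl⟩ := exists_eq_of_prime_dvd_prod_pow hp hq (hq1.trans (hD.1.1 _ hS))
    rw [dvd_prod_primes_iff hp hinj] at hq1 hq2
    exact Finset.mem_compl.1 hq2 hq1
  · intro hS
    obtain ⟨d, hd, hgcd⟩ := hD.2 _ (prod_primes_dvd_prod_pow hα S) hS
    refine hD.mem_of_forall_dvd hp hd (prod_primes_dvd_prod_pow hα Sᶜ) fun i hi => ?_
    rw [dvd_prod_primes_iff hp hinj, Finset.mem_compl]
    intro hiS
    have := Nat.dvd_gcd ((dvd_prod_primes_iff hp hinj S i).2 hiS) hi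
    rw [hgcd] at this
    exact (hp i).one_lt.ne' (Nat.dvd_one.1 this)

theorem IsMaxNSet.card_eq_sum (hp : ∀ i, (p i).Prime) (hinj : Function.Injective p)
    (hα : ∀ i, 1 ≤ α i) (hD : IsMaxNSet (∏ i, p i ^ α i) D) :
    D.card = ∑ S ∈ Finset.univ.filter (fun S : Finset ι => ∏ i ∈ S, p i ∈ D),
      ∏ i ∈ S, α i := by
  have hN : ∏ i, p i ^ α i ≠ 0 :=
    Finset.prod_ne_zero_iff.2 fun j _ => pow_ne_zero _ (hp j).ne_zero
  rw [Finset.card_eq_sum_card_fiberwise (f := fun d => Finset.univ.filter fun i => p i ∣ d)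
    (t := Finset.univ.filter (fun S : Finset ι => ∏ i ∈ S, p i ∈ D))]
  · refine Finset.sum_congr rfl fun S hS => ?_
    rw [← card_divisors_filter_primes_eq hp hinj S]
    congr 1
    ext d
    simp only [Finset.mem_filter, Nat.mem_divisors]
    refine and_congr_left fun hdS => ⟨fun hd => ⟨hD.1.1 d hd, hN⟩, fun hd => ?_⟩
    refine hD.mem_of_forall_dvd hp (Finset.mem_filter.1 hS).2 hd.1 fun i hi => ?_
    rw [dvd_prod_primes_iff hp hinj, ← hdS] at hi
    exact (Finset.mem_filter.1 hi).2
  · intro d hd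
    refine Finset.mem_coe.2 (Finset.mem_filter.2 ⟨Finset.mem_univ _, ?_⟩)
    refine hD.mem_of_forall_dvd hp hd (prod_primes_dvd_prod_pow hα _) fun i hi => ?_
    rw [dvd_prod_primes_iff hp hinj]
    exact Finset.mem_filter.2 ⟨Finset.mem_univ _, hi⟩

theorem prod_filter_dvd_eq (hp : ∀ i, (p i).Prime) (hinj : Function.Injective p) {d : ℕ}
    (hd : d ∣ ∏ i, p i) : ∏ i ∈ Finset.univ.filter (fun i => p i ∣ d), p i = d := by
  have hd' : d ∣ ∏ i, p i ^ (fun _ => 1 : ι → ℕ) i := by simpa using hd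
  have h := card_divisors_filter_primes_eq (α := fun _ => 1) hp hinj
    (Finset.univ.filter fun i => p i ∣ d)
  have hN : ∏ i, p i ^ (fun _ => 1 : ι → ℕ) i ≠ 0 :=
    Finset.prod_ne_zero_iff.2 fun j _ => pow_ne_zero _ (hp j).ne_zero
  rw [Finset.prod_const_one] at h
  refine Finset.card_le_one.1 h.le _ ?_ _ ?_
  · refine Finset.mem_filter.2 ⟨Nat.mem_divisors.2
      ⟨prod_primes_dvd_prod_pow (fun _ => le_rfl) _, hN⟩, ?_⟩
    ext i
    simp only [dvd_prod_primes_iff hp hinj, Finset.mem_filter, Finset.mem_univ, true_and]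
  · exact Finset.mem_filter.2 ⟨Nat.mem_divisors.2 ⟨hd', hN⟩, rfl⟩

end Divisors

/-- With `α₁ ≥ ⋯ ≥ α_u > α_{u+1} = ⋯ = α_n = 1` (0-indexed) and
`N = p₁^{α₁} ⋯ p_n^{α_n}`: let `D` be a maximal `N`-set of minimum size
`α_n ∏_{i=1}^{n-1} (α_i + 1)` with `{p_{u+1}, …, p_n} ∩ D = ∅`, let `N' = p₁ ⋯ p_n`,
`A = {d ∣ N' : d ∈ D}` and `A_n' = {d ∈ A : p_n ∤ d}`. Then for every `v ≤ u`,
`|{d ∈ A_n' : p_v ∣ d}| = |{d ∈ A_n' : p_v ∤ d}| = |A_n'|/2`. -/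
theorem stmt_18 (n u : ℕ) (hu : u < n) (p α : Fin n → ℕ)
    (hp : ∀ i, (p i).Prime) (hinj : Function.Injective p)
    (hanti : ∀ i j : Fin n, i ≤ j → α j ≤ α i)
    (hconst : ∀ i : Fin n, u ≤ (i : ℕ) → α i = 1)
    (hstrict : ∀ i : Fin n, (i : ℕ) < u → 1 < α i)
    (N : ℕ) (hN : N = ∏ i, p i ^ α i)
    (D : Finset ℕ) (hD : IsMaxNSet N D)
    (hcard : D.card = α ⟨n - 1, by omega⟩ *
      ∏ i ∈ Finset.univ.erase ⟨n - 1, by omega⟩, (α i + 1))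
    (hdisj : ∀ i : Fin n, u ≤ (i : ℕ) → p i ∉ D)
    (N' : ℕ) (hN' : N' = ∏ i, p i)
    (An' : Finset ℕ)
    (hAn' : An' = D.filter fun d => d ∣ N' ∧ ¬ p ⟨n - 1, by omega⟩ ∣ d) :
    ∀ v : Fin n, (v : ℕ) < u →
      (An'.filter fun d => p v ∣ d).card = (An'.filter fun d => ¬ p v ∣ d).card ∧
      2 * (An'.filter fun d => p v ∣ d).card = An'.card := by
  have hα : ∀ i, 1 ≤ α i := by
    intro i
    by_cases h : (i : ℕ) < u
    · exact (hstrict i h).le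
    · exact (hconst i (not_lt.1 h)).ge
  subst hN hN' hAn'
  intro v hvu
  set z : Fin n := ⟨n - 1, by omega⟩ with hz
  have hαz : α z = 1 := hconst z (by simp only [hz]; omega)
  have hvz : v ≠ z := by
    intro h
    have h1 : (v : ℕ) = n - 1 := congrArg Fin.val h
    omega
  have hup : ∀ S T : Finset (Fin n), S ⊆ T → ∏ i ∈ S, p i ∈ D → ∏ i ∈ T, p i ∈ D :=
    fun S T hST => hD.prod_mem_of_subset hp hinj hα hST
  have hexc : weightExcess (fun i => (α i : ℤ)) (Finset.univ.erase z)
      (fun S => ∏ i ∈ S, p i ∈ D) = 0 := by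
    have h1 := sum_prod_eq_add_weightExcess (fun i => (α i : ℤ)) (z := z) (by simp [hαz])
      (fun S => ∏ i ∈ S, p i ∈ D) (hD.prod_compl_mem_iff hp hinj hα)
    have h2 := hD.card_eq_sum hp hinj hα
    rw [hcard, hαz, one_mul] at h2
    have h3 := congrArg (Nat.cast : ℕ → ℤ) h2
    push_cast at h3
    linarith
  have hins : insert v ((Finset.univ.erase z).erase v) = Finset.univ.erase z :=
    Finset.insert_erase (Finset.mem_erase.2 ⟨hvz, Finset.mem_univ _⟩)
  rw [← hins] at hexc
  have hdrop : ∀ T ⊆ (Finset.univ.erase z).erase v,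
      ∏ i ∈ insert v T, p i ∈ D → ∏ i ∈ T, p i ∈ D := fun T hT hTD =>
    of_insert_of_weightExcess_eq_zero (a := fun i => (α i : ℤ))
      (fun i => by exact_mod_cast hα i) (Finset.notMem_erase _ _)
      (by exact_mod_cast hstrict v hvu) (fun S => ∏ i ∈ S, p i ∈ D) hup hexc hT hTD
  have hprod : ∀ S : Finset (Fin n), ∏ i ∈ S, p i ∣ ∏ i, p i := fun S =>
    Finset.prod_dvd_prod_of_subset _ _ _ (Finset.subset_univ S)
  have heq : ((D.filter fun d => d ∣ ∏ i, p i ∧ ¬ p z ∣ d).filter fun d => p v ∣ d).card =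
      ((D.filter fun d => d ∣ ∏ i, p i ∧ ¬ p z ∣ d).filter fun d => ¬ p v ∣ d).card := by
    refine Finset.card_nbij' (fun d => d / p v) (fun d => p v * d) ?_ ?_ ?_ ?_
    · intro d hd
      obtain ⟨hd, hvd⟩ := Finset.mem_filter.1 hd
      obtain ⟨hdD, hdN, hzd⟩ := Finset.mem_filter.1 hd
      obtain ⟨S, rfl⟩ : ∃ S, ∏ i ∈ S, p i = d := ⟨_, prod_filter_dvd_eq hp hinj hdN⟩
      rw [dvd_prod_primes_iff hp hinj] at hvd hzd
      have hdiv : (∏ i ∈ S, p i) / p v = ∏ i ∈ S.erase v, p i := by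
        rw [← Finset.mul_prod_erase S p hvd, Nat.mul_div_cancel_left _ (hp v).pos]
      have hsub : S.erase v ⊆ (Finset.univ.erase z).erase v :=
        Finset.erase_subset_erase _ fun i hi =>
          Finset.mem_erase.2 ⟨fun h => hzd (h ▸ hi), Finset.mem_univ _⟩
      refine Finset.mem_coe.2 (Finset.mem_filter.2 ⟨Finset.mem_filter.2 ?_, ?_⟩)
      · simp only [hdiv]
        refine ⟨hdrop _ hsub (by rwa [Finset.insert_erase hvd]), hprod _, ?_⟩
        rw [dvd_prod_primes_iff hp hinj]
        exact fun h => hzd (Finset.mem_of_mem_erase h)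
      · simp only [hdiv]
        rw [dvd_prod_primes_iff hp hinj]
        exact Finset.notMem_erase _ _
    · intro d hd
      obtain ⟨hd, hvd⟩ := Finset.mem_filter.1 hd
      obtain ⟨hdD, hdN, hzd⟩ := Finset.mem_filter.1 hd
      obtain ⟨S, rfl⟩ : ∃ S, ∏ i ∈ S, p i = d := ⟨_, prod_filter_dvd_eq hp hinj hdN⟩
      rw [dvd_prod_primes_iff hp hinj] at hvd hzd
      refine Finset.mem_coe.2 (Finset.mem_filter.2 ⟨Finset.mem_filter.2 ?_, dvd_mul_right _ _⟩)
      simp only [← Finset.prod_insert hvd]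
      refine ⟨hup _ _ (Finset.subset_insert _ _) hdD, hprod _, ?_⟩
      rw [dvd_prod_primes_iff hp hinj, Finset.mem_insert]
      exact fun h => h.elim (fun h => hvz h.symm) hzd
    · exact fun d hd => Nat.mul_div_cancel' (Finset.mem_filter.1 hd).2
    · exact fun d _ => Nat.mul_div_cancel_left _ (hp v).pos
  refine ⟨heq, ?_⟩
  rw [← Finset.card_filter_add_card_filter_not (s := D.filter _) (fun d => p v ∣ d), ← heq,
    two_mul]
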